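/- arXiv:2210.00340 — 2 statements merged into one kernel-verified Lean document; each statement's English description precedes it below -/
import Mathlib

section
/- Let $d_r, d_c \ge 1$ and let $B, \widehat B \in \mathbb{R}^{d_r \times d_c}$ and $h > 0$. Suppose that for every row index $j \in [d_r]$ the row-wise error bound $\big(\sum_{k=1}^{d_c} (\widehat B_{jk} - B_{jk})^2\big)^{1/2} \le h/4$ holds. Then the targeted set $\mathcal{C} = \{(j,k) : \widehat B_{jk} \ge \max_{(l,m)} \widehat B_{lm} - h/2\}$ contains no element of the sub-optimal set $\mathcal{S}^h_{sub} = \{(j,k) : B_{jk} < \max_{(l,m)} B_{lm} - h\}$; equivalently, $\mathcal{C} \subseteq \mathcal{S}^h_{opt} = \{(j,k) : B_{jk} \ge \max_{(l,m)} B_{lm} - h\}$. -/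
theorem abs_le_sqrt_sum_sq {ι : Type*} [Fintype ι] (f : ι → ℝ) (i : ι) :
    |f i| ≤ Real.sqrt (∑ k, f k ^ 2) :=
  Real.abs_le_sqrt <|
    Finset.single_le_sum (f := fun k => f k ^ 2) (fun _ _ => sq_nonneg _) (Finset.mem_univ i)

/-- If every row of the estimate `Bhat` is within `h/4` of the corresponding
row of `B` in ℓ₂-norm, then the targeted set
`C = {(j,k) : Bhat j k ≥ max Bhat - h/2}` is contained in the near-optimal set
`S_opt = {(j,k) : B j k ≥ max B - h}` (equivalently, `C` contains no element of the
sub-optimal set `S_sub = {(j,k) : B j k < max B - h}`). -/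
theorem targeted_set_subset_near_optimal (dr dc : ℕ) (hdr : 1 ≤ dr) (hdc : 1 ≤ dc)
    (B Bhat : Fin dr → Fin dc → ℝ) (h : ℝ) (hh : 0 < h)
    (hrow : ∀ j : Fin dr, Real.sqrt (∑ k, (Bhat j k - B j k) ^ 2) ≤ h / 4) :
    {p : Fin dr × Fin dc |
        Finset.univ.sup' ⟨(⟨0, hdr⟩, ⟨0, hdc⟩), Finset.mem_univ _⟩
            (fun q : Fin dr × Fin dc => Bhat q.1 q.2) - h / 2 ≤ Bhat p.1 p.2} ⊆
      {p : Fin dr × Fin dc |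
        Finset.univ.sup' ⟨(⟨0, hdr⟩, ⟨0, hdc⟩), Finset.mem_univ _⟩
            (fun q : Fin dr × Fin dc => B q.1 q.2) - h ≤ B p.1 p.2} := by
  have entry (j : Fin dr) (k : Fin dc) : |Bhat j k - B j k| ≤ h / 4 :=
    (abs_le_sqrt_sum_sq (fun k => Bhat j k - B j k) k).trans (hrow j)
  intro p hp
  rw [Set.mem_ofPred_eq] at hp ⊢
  rw [sub_le_iff_le_add]
  refine Finset.sup'_le _ _ fun q _ => ?_
  have hq := Finset.le_sup' (fun q : Fin dr × Fin dc => Bhat q.1 q.2) (Finset.mem_univ q)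
  have hBq := abs_le.mp (entry q.1 q.2)
  have hBp := abs_le.mp (entry p.1 p.2)
  linarith [hBq.1, hBp.2]
end

section
/- Let $\rho \ge 24$ be an integer, set $a = 2\rho\lfloor \log \rho \rfloor$, and let $t$ be an integer with $t \ge 2\rho \log \rho$. Then the quantity $\theta = a + \sum_{i=a+1}^{t} \frac{\rho}{\,i - \rho\log \rho + 1\,}$ satisfies $\rho \log t \le \theta \le 3\rho \log t$. -/
theorem Real.log_add_one_sub_log_le {x : ℝ} (hx : 0 < x) :
    Real.log (x + 1) - Real.log x ≤ 1 / x := by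
  rw [← Real.log_div (by positivity) hx.ne']
  have h := Real.log_le_sub_one_of_pos (show 0 < (x + 1) / x by positivity)
  have h' : (x + 1) / x - 1 = 1 / x := by field_simp; ring
  linarith

theorem Real.one_div_add_one_le_log_sub_log {x : ℝ} (hx : 0 < x) :
    1 / (x + 1) ≤ Real.log (x + 1) - Real.log x := by
  rw [← Real.log_div (by positivity) hx.ne']
  have h := Real.one_sub_inv_le_log_of_pos (show 0 < (x + 1) / x by positivity)
  have h' : 1 - ((x + 1) / x)⁻¹ = 1 / (x + 1) := by field_simp; ring
  linarith

theorem log_sub_log_le_sum_one_div (b : ℝ) (a t : ℕ) (hat : a ≤ t) (hb : b < a) :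
    Real.log ((t : ℝ) - b + 2) - Real.log ((a : ℝ) - b + 2) ≤
      ∑ i ∈ Finset.Icc (a + 1) t, 1 / ((i : ℝ) - b + 1) := by
  induction t, hat using Nat.le_induction with
  | base => simp
  | succ t hat ih =>
    have hc : (a : ℝ) ≤ t := by exact_mod_cast hat
    rw [Finset.sum_Icc_succ_top (by omega)]
    have h := Real.log_add_one_sub_log_le (x := (t : ℝ) - b + 2) (by linarith)
    push_cast
    rw [show (t : ℝ) + 1 - b + 2 = t - b + 2 + 1 by ring,
      show (t : ℝ) + 1 - b + 1 = t - b + 2 by ring]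
    linarith

theorem sum_one_div_le_log_sub_log (b : ℝ) (a t : ℕ) (hat : a ≤ t) (hb : b < a) :
    ∑ i ∈ Finset.Icc (a + 1) t, 1 / ((i : ℝ) - b + 1) ≤
      Real.log ((t : ℝ) - b + 1) - Real.log ((a : ℝ) - b + 1) := by
  induction t, hat using Nat.le_induction with
  | base => simp
  | succ t hat ih =>
    have hc : (a : ℝ) ≤ t := by exact_mod_cast hat
    rw [Finset.sum_Icc_succ_top (by omega)]
    have h := Real.one_div_add_one_le_log_sub_log (x := (t : ℝ) - b + 1) (by linarith)
    push_cast
    rw [show (t : ℝ) + 1 - b + 1 = t - b + 1 + 1 by ring]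
    linarith

theorem Real.three_le_log {x : ℝ} (hx : 24 ≤ x) : 3 ≤ Real.log x := by
  rw [Real.le_log_iff_exp_le (by linarith)]
  have h : Real.exp 3 = Real.exp 1 ^ 3 := by rw [← Real.exp_nat_mul]; norm_num
  have h' : Real.exp 1 ^ 3 ≤ 2.72 ^ 3 :=
    pow_le_pow_left₀ (Real.exp_pos 1).le (by linarith [Real.exp_one_lt_d9]) 3
  rw [h]
  exact h'.trans (by norm_num; linarith)


/-- For `ρ ≥ 24`, `a = 2ρ⌊log ρ⌋` and integer `t ≥ 2ρ log ρ`, the expected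
number of forced samples `θ = a + ∑_{i=a+1}^{t} ρ/(i - ρ log ρ + 1)` satisfies
`ρ log t ≤ θ ≤ 3 ρ log t`. -/
theorem expected_forced_samples_bounds (ρ t : ℕ) (hρ : 24 ≤ ρ)
    (ht : 2 * (ρ : ℝ) * Real.log ρ ≤ (t : ℝ)) :
    (ρ : ℝ) * Real.log t ≤
        ((2 * ρ * ⌊Real.log ρ⌋₊ : ℕ) : ℝ) +
          ∑ i ∈ Finset.Icc (2 * ρ * ⌊Real.log ρ⌋₊ + 1) t,
            (ρ : ℝ) / ((i : ℝ) - (ρ : ℝ) * Real.log ρ + 1) ∧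
      ((2 * ρ * ⌊Real.log ρ⌋₊ : ℕ) : ℝ) +
          ∑ i ∈ Finset.Icc (2 * ρ * ⌊Real.log ρ⌋₊ + 1) t,
            (ρ : ℝ) / ((i : ℝ) - (ρ : ℝ) * Real.log ρ + 1) ≤
        3 * (ρ : ℝ) * Real.log t := by
  have hr : (24 : ℝ) ≤ ρ := by exact_mod_cast hρ
  have hL3 : 3 ≤ Real.log ρ := Real.three_le_log hr
  have hn3 : 3 ≤ ⌊Real.log ρ⌋₊ := Nat.le_floor (by exact_mod_cast hL3)
  have hnL : (⌊Real.log ρ⌋₊ : ℝ) ≤ Real.log ρ := Nat.floor_le (by linarith)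
  have hLn : Real.log ρ < ⌊Real.log ρ⌋₊ + 1 := Nat.lt_floor_add_one _
  have hexp : Real.exp (Real.log ρ) = ρ := Real.exp_log (by linarith)
  set n := ⌊Real.log ρ⌋₊
  set L := Real.log ρ
  have hn3' : (3 : ℝ) ≤ n := by exact_mod_cast hn3
  have ha : ((2 * ρ * n : ℕ) : ℝ) = 2 * ρ * n := by push_cast; ring
  have haL : (2 : ℝ) * ρ * n ≤ 2 * ρ * L := by gcongr
  have hat : 2 * ρ * n ≤ t := by
    have : ((2 * ρ * n : ℕ) : ℝ) ≤ t := by linarith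
    exact_mod_cast this
  have hu : (ρ : ℝ) * 2 ≤ 2 * ρ * n - ρ * L := by nlinarith
  have hb : (ρ : ℝ) * L < ((2 * ρ * n : ℕ) : ℝ) := by linarith
  have hbρ : (ρ : ℝ) * 3 ≤ ρ * L := by gcongr
  have hsum : ∑ i ∈ Finset.Icc (2 * ρ * n + 1) t, (ρ : ℝ) / ((i : ℝ) - ρ * L + 1) =
      ρ * ∑ i ∈ Finset.Icc (2 * ρ * n + 1) t, 1 / ((i : ℝ) - ρ * L + 1) := by
    rw [Finset.mul_sum]
    exact Finset.sum_congr rfl fun i _ => by ring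
  have hlo := log_sub_log_le_sum_one_div _ _ _ hat hb
  have hup := sum_one_div_le_log_sub_log _ _ _ hat hb
  rw [hsum]
  set S := ∑ i ∈ Finset.Icc (2 * ρ * n + 1) t, 1 / ((i : ℝ) - ρ * L + 1)
  rw [ha] at hlo hup ⊢
  have ht0 : (0 : ℝ) < t := by linarith
  constructor
  · have key : Real.log t + Real.log (2 * ρ * n - ρ * L + 2) ≤
        2 * n + Real.log (t - ρ * L + 2) := by
      have hpos : (0 : ℝ) < 2 * ρ * n - ρ * L + 2 := by linarith
      have hpos' : (0 : ℝ) < t - ρ * L + 2 := by linarith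
      rw [← Real.log_exp (2 * n), ← Real.log_mul ht0.ne' hpos.ne',
        ← Real.log_mul (Real.exp_pos _).ne' hpos'.ne']
      apply Real.log_le_log (by positivity)
      have hE : Real.exp (2 * n) = ρ * Real.exp (2 * n - L) := by
        nth_rw 1 [← hexp]
        rw [← Real.exp_add]
        ring_nf
      have hq : 1 + 2 * (2 * n - L) ≤ Real.exp (2 * n - L) := by
        have := Real.quadratic_le_exp_of_nonneg (show (0 : ℝ) ≤ 2 * n - L by linarith)
        nlinarith
      have hq' : (ρ : ℝ) * (1 + 2 * (2 * n - L)) ≤ ρ * Real.exp (2 * n - L) := by gcongr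
      have hE' : 2 * (2 * ρ * n - ρ * L + 2) ≤ Real.exp (2 * n) := by
        rw [hE]
        linarith
      calc (t : ℝ) * (2 * ρ * n - ρ * L + 2)
          = (2 * (2 * ρ * n - ρ * L + 2)) * (t / 2) := by ring
        _ ≤ Real.exp (2 * n) * (t - ρ * L + 2) := by
          gcongr
          linarith
    have : (ρ : ℝ) * Real.log t ≤ ρ * (2 * n + S) := by
      gcongr
      linarith
    linarith
  · have h1 : L ≤ Real.log t := Real.log_le_log (by linarith) (by linarith)
    have h2 : Real.log (t - ρ * L + 1) ≤ Real.log t :=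
      Real.log_le_log (by linarith) (by linarith)
    have h3 : 0 ≤ Real.log (2 * ρ * n - ρ * L + 1) := Real.log_nonneg (by linarith)
    have : (ρ : ℝ) * (2 * n + S) ≤ ρ * (3 * Real.log t) := by
      gcongr
      linarith
    linarith
end
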